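/- Let K ⊂ ℚ̄ be a number field, h_1(z), …, h_r(z) ∈ K[[z]], and α ∈ ℚ̄. Suppose there exist polynomials w_1(z), …, w_r(z) ∈ ℚ̄[z] such that w_1(z)h_1(z) + ⋯ + w_r(z)h_r(z) = 0 as formal power series, with w_i(α) = 0 for every index i in a subset I ⊂ {1,…,r} and w_{i_0}(α) ≠ 0 for some index i_0 ∈ {1,…,r} \ I. Then there exist polynomials w'_1(z), …, w'_r(z) ∈ K[z] such that w'_1(z)h_1(z) + ⋯ + w'_r(z)h_r(z) = 0, with w'_i(α) = 0 for every i ∈ I and w'_{i_0}(α) ≠ 0. -/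

import Mathlib

noncomputable section

/-- The derivative `d/dz` of a formal power series over `ℂ`. -/
def psD (f : PowerSeries ℂ) : PowerSeries ℂ :=
  PowerSeries.mk fun n => ((n : ℂ) + 1) * PowerSeries.coeff (n + 1) f

/-- The Mahler operator `σ_q : f(z) ↦ f(z^q)` on formal power series over `ℂ`. -/
def psSigma (q : ℕ) (f : PowerSeries ℂ) : PowerSeries ℂ :=
  PowerSeries.mk fun n => if q ∣ n then PowerSeries.coeff (n / q) f else 0

/-- The canonical embedding of polynomials into power series. -/
def polyPS : Polynomial ℂ →+* PowerSeries ℂ := Polynomial.coeToPowerSeries.ringHom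

/-- The power series `∑ (a n / n!) zⁿ` attached to a sequence `a` of coefficients. -/
def ePS (a : ℕ → ℂ) : PowerSeries ℂ := PowerSeries.mk fun n => a n / (n.factorial : ℂ)

/-- `IsE a` : the power series `∑ (a n / n!) zⁿ` is an E-function: its coefficients are
algebraic, it satisfies a nonzero linear differential equation over `ℚ̄[z]`, and the size of
the conjugates of the `a n` as well as their common denominators grow at most geometrically. -/
def IsE (a : ℕ → ℂ) : Prop :=
  (∀ n, IsAlgebraic ℚ (a n)) ∧
  (∃ (m : ℕ) (p : ℕ → Polynomial ℂ),
      (∀ i k, IsAlgebraic ℚ ((p i).coeff k)) ∧ (∃ i, i ≤ m ∧ p i ≠ 0) ∧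
      ∑ i ∈ Finset.range (m + 1), polyPS (p i) * psD^[i] (ePS a) = 0) ∧
  (∃ C : ℝ, 0 < C ∧ ∃ d : ℕ → ℕ, ∀ n : ℕ, 1 ≤ n →
      1 ≤ d n ∧ (d n : ℝ) ≤ C ^ n ∧
      (∀ σ : (integralClosure ℚ ℂ) →+* ℂ, ∀ h : a n ∈ integralClosure ℚ ℂ,
        ‖σ ⟨a n, h⟩‖ ≤ C ^ n) ∧
      (∀ i, 1 ≤ i → i ≤ n → IsIntegral ℤ ((d n : ℂ) * a i)))

/-- The value at `α` of the E-function with coefficient sequence `a`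
(E-functions are entire, so this series converges for all `α`). -/
def evalE (a : ℕ → ℂ) (α : ℂ) : ℂ := ∑' n : ℕ, a n / (n.factorial : ℂ) * α ^ n

/-- `IsM q f` : the formal power series `f` is an M_q-function, i.e. it has algebraic
coefficients and satisfies a linear `σ_q`-difference equation over `ℚ̄[z]` with
not-all-zero polynomial coefficients. -/
def IsM (q : ℕ) (f : PowerSeries ℂ) : Prop :=
  (∀ n, IsAlgebraic ℚ (PowerSeries.coeff n f)) ∧
  ∃ (m : ℕ) (p : ℕ → Polynomial ℂ),
    (∀ i k, IsAlgebraic ℚ ((p i).coeff k)) ∧ (∃ i, i ≤ m ∧ p i ≠ 0) ∧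
    ∑ i ∈ Finset.range (m + 1), polyPS (p i) * (psSigma q)^[i] f = 0

/-- `MahlerValue f α v` : the meromorphic extension of (the sum of) the power series `f`
to the open unit disk has no pole at `α` and takes the value `v` there. -/
def MahlerValue (f : PowerSeries ℂ) (α v : ℂ) : Prop :=
  ∃ F : ℂ → ℂ, MeromorphicOn F (Metric.ball (0 : ℂ) 1) ∧
    (∀ᶠ z in nhds (0 : ℂ), HasSum (fun n => PowerSeries.coeff n f * z ^ n) (F z)) ∧
    AnalyticAt ℂ F α ∧ F α = v

/-- The power series `f` converges (hence defines an analytic function) on the open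
disk `D(0,R)`. -/
def AnOnBall (f : PowerSeries ℂ) (R : ℝ) : Prop :=
  ∀ z : ℂ, ‖z‖ < R → Summable fun n => PowerSeries.coeff n f * z ^ n

/-- The value at `z` of (the sum of) the power series `f`. -/
def psEval (f : PowerSeries ℂ) (z : ℂ) : ℂ := ∑' n : ℕ, PowerSeries.coeff n f * z ^ n

/-- `Banal fv α P` : the homogeneous algebraic relation `P` among the values at `α` of the
power series `fv 1, …, fv r` is banal: it is the specialization at `z = α` of some
`Q ∈ ℚ̄[z, X₁, …, X_r]`, homogeneous in `X₁, …, X_r`, with `Q(z, fv 1, …, fv r) = 0`. -/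
def Banal {r : ℕ} (fv : Fin r → PowerSeries ℂ) (α : ℂ) (P : MvPolynomial (Fin r) ℂ) : Prop :=
  ∃ Q : MvPolynomial (Fin r) (Polynomial ℂ),
    (∀ v k, IsAlgebraic ℚ ((MvPolynomial.coeff v Q).coeff k)) ∧
    (∃ e, Q.IsHomogeneous e) ∧
    MvPolynomial.eval₂ polyPS fv Q = 0 ∧
    MvPolynomial.map (Polynomial.evalRingHom α) Q = P

/-- `Eset S` : the set of values at `z = 1` of all E-functions with coefficients in `S`. -/
def Eset (S : Set ℂ) : Set ℂ :=
  {x | ∃ a : ℕ → ℂ, IsE a ∧ (∀ n, a n ∈ S) ∧ x = evalE a 1}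

/-- `Mset q α S` : the set of values at `α` of all M_q-functions with coefficients in `S`
having no pole at `α`. -/
def Mset (q : ℕ) (α : ℂ) (S : Set ℂ) : Set ℂ :=
  {x | ∃ f : PowerSeries ℂ, IsM q f ∧ (∀ n, PowerSeries.coeff n f ∈ S) ∧ MahlerValue f α x}

/-- Apply an additive map to every coefficient of a polynomial. -/
def Polynomial.mapCoeff (f : ℂ →+ ℂ) (p : Polynomial ℂ) : Polynomial ℂ :=
  ∑ k ∈ p.support, Polynomial.monomial k (f (p.coeff k))

theorem Polynomial.coeff_mapCoeff (f : ℂ →+ ℂ) (p : Polynomial ℂ) (n : ℕ) :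
    (p.mapCoeff f).coeff n = f (p.coeff n) := by
  simp only [Polynomial.mapCoeff, Polynomial.finsetSum_coeff, Polynomial.coeff_monomial,
    Finset.sum_ite_eq', Polynomial.mem_support_iff]
  split_ifs with hn
  · rfl
  · rw [not_not.mp hn, map_zero]

theorem Polynomial.eval_mapCoeff (f : ℂ →+ ℂ) (p : Polynomial ℂ) (x : ℂ) :
    (p.mapCoeff f).eval x = ∑ k ∈ p.support, f (p.coeff k) * x ^ k := by
  simp [Polynomial.mapCoeff, Polynomial.eval_finsetSum]

/-- A `K`-linear map applied to the coefficients of the polynomials preserves every linear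
relation among power series with coefficients in `K`. -/
theorem sum_polyPS_mapCoeff_mul_eq_zero (K : Subfield ℂ) {ι : Type*} [Fintype ι]
    (h : ι → PowerSeries ℂ) (hcoef : ∀ i n, PowerSeries.coeff n (h i) ∈ K)
    (w : ι → Polynomial ℂ) (hrel : ∑ i, polyPS (w i) * h i = 0) (f : ℂ →ₗ[K] ℂ) :
    ∑ i, polyPS ((w i).mapCoeff f.toAddMonoidHom) * h i = 0 := by
  ext n
  have key := congrArg (fun s => f (PowerSeries.coeff n s)) hrel
  simp only [map_sum, map_zero, PowerSeries.coeff_mul] at key ⊢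
  rw [← key]
  refine Finset.sum_congr rfl fun i _ => Finset.sum_congr rfl fun m _ => ?_
  have hsmul := f.map_smul ⟨_, hcoef i m.2⟩ ((w i).coeff m.1)
  simp only [Subfield.smul_def, smul_eq_mul] at hsmul
  simp only [polyPS, Polynomial.coeToPowerSeries.ringHom_apply, Polynomial.coeff_coe,
    Polynomial.coeff_mapCoeff, LinearMap.toAddMonoidHom_coe]
  rw [mul_comm ((w i).coeff m.1), hsmul, mul_comm]

open IntermediateField in
/-- If `α` is algebraic over `K` and `x ≠ 0`, some `K(α)`-linear map `φ : ℂ → ℂ` does not vanish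
at `x` and is of the form `∑ j, ℓ j * α ^ j` with `K`-linear, `K`-valued maps `ℓ j`. -/
theorem exists_linear_descent (K : Subfield ℂ) {α : ℂ} (hα : IsIntegral K α) {x : ℂ}
    (hx : x ≠ 0) :
    ∃ (d : ℕ) (l : Fin d → ℂ →ₗ[K] ℂ) (φ : ℂ →+ ℂ), (∀ j c, l j c ∈ K) ∧
      (∀ c, φ c = ∑ j, l j c * α ^ (j : ℕ)) ∧ (∀ c k, φ (c * α ^ k) = φ c * α ^ k) ∧
      φ x ≠ 0 := by
  obtain ⟨φ, hφ⟩ : ∃ φ : Module.Dual K⟮α⟯ ℂ, φ x ≠ 0 := by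
    by_contra! hzero
    exact hx ((Module.forall_dual_apply_eq_zero_iff K⟮α⟯ x).mp hzero)
  let pb := adjoin.powerBasis hα
  have hgen : algebraMap K⟮α⟯ ℂ pb.gen = α := AdjoinSimple.algebraMap_gen K α
  refine ⟨pb.dim, fun j => Algebra.linearMap K ℂ ∘ₗ pb.basis.coord j ∘ₗ φ.restrictScalars K,
    (algebraMap K⟮α⟯ ℂ).toAddMonoidHom.comp φ.toAddMonoidHom, fun j c => ?_, fun c => ?_,
    fun c k => ?_, ?_⟩
  · exact SetLike.coe_mem (pb.basis.coord j (φ c))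
  · have hsum := congrArg (algebraMap K⟮α⟯ ℂ) (pb.basis.sum_repr (φ c))
    simp only [map_sum, Algebra.smul_def, map_mul, pb.basis_eq_pow, map_pow, hgen,
      ← IsScalarTower.algebraMap_apply] at hsum
    exact hsum.symm
  · have hsmul := congrArg (algebraMap K⟮α⟯ ℂ) (φ.map_smul (pb.gen ^ k) c)
    simp only [Algebra.smul_def, map_mul, map_pow, hgen, Algebra.algebraMap_self,
      RingHom.id_apply] at hsmul
    rw [mul_comm c, mul_comm _ (α ^ k)]
    exact hsmul
  · exact fun hzero => hφ ((algebraMap K⟮α⟯ ℂ).injective (hzero.trans (map_zero _).symm))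

/-- (Descent lemma.) If `h₁, …, h_r ∈ K[[z]]` with `K` a number field and
`w₁ h₁ + ⋯ + w_r h_r = 0` for polynomials `w_i ∈ ℚ̄[z]` with `w_i(α) = 0` for `i ∈ I` and
`w_{i₀}(α) ≠ 0` for some `i₀ ∉ I`, then the same can be achieved with polynomials in `K[z]`. -/
theorem descent_lemma
    (K : Subfield ℂ) [FiniteDimensional ℚ K] (hKalg : ∀ x ∈ K, IsAlgebraic ℚ x)
    (r : ℕ) (h : Fin r → PowerSeries ℂ)
    (hcoef : ∀ i n, PowerSeries.coeff n (h i) ∈ K)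
    (α : ℂ) (hαalg : IsAlgebraic ℚ α)
    (w : Fin r → Polynomial ℂ) (hwalg : ∀ i k, IsAlgebraic ℚ ((w i).coeff k))
    (hrel : ∑ i, polyPS (w i) * h i = 0)
    (I : Finset (Fin r)) (hI : ∀ i ∈ I, Polynomial.eval α (w i) = 0)
    (i₀ : Fin r) (hi₀ : i₀ ∉ I) (hi₀v : Polynomial.eval α (w i₀) ≠ 0) :
    ∃ w' : Fin r → Polynomial ℂ,
      (∀ i k, (w' i).coeff k ∈ K) ∧
      ∑ i, polyPS (w' i) * h i = 0 ∧
      (∀ i ∈ I, Polynomial.eval α (w' i) = 0) ∧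
      Polynomial.eval α (w' i₀) ≠ 0 := by
  have hα : IsIntegral K α := (hαalg.tower_top K).isIntegral
  obtain ⟨d, l, φ, hlK, hφl, hφα, hφ⟩ := exists_linear_descent K hα hi₀v
  let w' : Fin r → Polynomial ℂ := fun i =>
    ∑ j : Fin d, Polynomial.X ^ (j : ℕ) * (w i).mapCoeff (l j).toAddMonoidHom
  have heval : ∀ i, Polynomial.eval α (w' i) = φ (Polynomial.eval α (w i)) := fun i => by
    rw [Polynomial.eval_eq_sum (p := w i), Polynomial.sum_def, map_sum]
    simp only [w', Polynomial.eval_finsetSum, Polynomial.eval_mul, Polynomial.eval_pow,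
      Polynomial.eval_X, Polynomial.eval_mapCoeff, hφα, hφl, Finset.mul_sum, Finset.sum_mul,
      LinearMap.toAddMonoidHom_coe]
    rw [Finset.sum_comm]
    exact Finset.sum_congr rfl fun k _ => Finset.sum_congr rfl fun j _ => by ring
  refine ⟨w', fun i k => ?_, ?_, fun i hi => ?_, ?_⟩
  · simp only [w', Polynomial.finsetSum_coeff, Polynomial.coeff_X_pow_mul',
      Polynomial.coeff_mapCoeff]
    refine sum_mem fun j _ => ?_
    split_ifs
    · exact hlK j _
    · exact K.zero_mem
  · simp only [w', map_sum, map_mul, Finset.sum_mul, mul_assoc]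
    rw [Finset.sum_comm]
    refine Finset.sum_eq_zero fun j _ => ?_
    rw [← Finset.mul_sum, sum_polyPS_mapCoeff_mul_eq_zero K h hcoef w hrel, mul_zero]
  · rw [heval, hI i hi, map_zero]
  · rwa [heval]
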